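/- arXiv:2207.04635 — 6 statements merged into one kernel-verified Lean document; each statement's English description precedes it below -/
import Mathlib

section
/- Let B⁰ ∈ ℝ satisfy F(B⁰) = (λ_h − λ_l − λ_b)/(λ_h − μ_h). Then B⁰ is a global minimizer of the expected daily cost: J(B⁰) ≤ J(B) for every B ∈ ℝ. -/
open MeasureTheory

/-- The subgradient inequality at `b` for the convex function `B ↦ p (h - B)⁺ - q (B - h)⁺`. -/
lemma posPart_cost_subgradient {p q : ℝ} (hpq : q ≤ p) (h b B : ℝ) :
    p * max (h - b) 0 - q * max (b - h) 0
        + (B - b) * (-p + (p - q) * (Set.Iic b).indicator 1 h)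
      ≤ p * max (h - B) 0 - q * max (B - h) 0 := by
  have hsplit (x : ℝ) : max (h - x) 0 = max (x - h) 0 + (h - x) := by
    rcases le_total h x with hx | hx
    · rw [max_eq_right (by linarith), max_eq_left (by linarith)]; ring
    · rw [max_eq_left (by linarith), max_eq_right (by linarith)]; ring
  have hconv : max (b - h) 0 + (B - b) * (Set.Iic b).indicator 1 h ≤ max (B - h) 0 := by
    by_cases hb : h ≤ b
    · have : (Set.Iic b).indicator (1 : ℝ → ℝ) h = 1 := by simp [hb]
      rw [this, max_eq_left (by linarith)]
      linarith [le_max_left (B - h) 0]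
    · have : (Set.Iic b).indicator (1 : ℝ → ℝ) h = 0 := by simp [hb]
      rw [this, max_eq_right (by linarith)]
      linarith [le_max_right (B - h) 0]
  rw [hsplit b, hsplit B]
  linarith [mul_le_mul_of_nonneg_left hconv (sub_nonneg.mpr hpq)]

/-- If `B⁰` satisfies the first-order condition
`F(B⁰) = (λ_h − λ_l − λ_b)/(λ_h − μ_h)`, then `B⁰` globally minimizes the
expected daily cost `J`. -/
theorem optimal_storage_global_min
    {Ω : Type*} [MeasurableSpace Ω] (ℙ : Measure Ω) [IsProbabilityMeasure ℙ]
    (Hh Hl : Ω → ℝ) (hHh : Integrable Hh ℙ) (hHl : Integrable Hl ℙ)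
    (lamh muh laml lamb : ℝ) (hprice : lamh > muh)
    (F : ℝ → ℝ) (hF : ∀ x, F x = (ℙ {ω | Hh ω ≤ x}).toReal)
    (J : ℝ → ℝ)
    (hJ : ∀ B, J B = lamb * B +
      ∫ ω, (lamh * max (Hh ω - B) 0 - muh * max (B - Hh ω) 0
            + laml * (Hl ω + B)) ∂ℙ)
    (B0 : ℝ) (hB0 : F B0 = (lamh - laml - lamb) / (lamh - muh)) :
    ∀ B : ℝ, J B0 ≤ J B := by
  intro B
  have hint (b : ℝ) : Integrable (fun ω => lamh * max (Hh ω - b) 0 - muh * max (b - Hh ω) 0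
      + laml * (Hl ω + b)) ℙ :=
    (((hHh.sub (integrable_const b)).pos_part.const_mul lamh).sub
      (((integrable_const b).sub hHh).pos_part.const_mul muh)).add
      ((hHl.add (integrable_const b)).const_mul laml)
  have hS : NullMeasurableSet {ω | Hh ω ≤ B0} ℙ :=
    nullMeasurableSet_le hHh.aemeasurable aemeasurable_const
  have hI : Integrable ({ω | Hh ω ≤ B0}.indicator (1 : Ω → ℝ)) ℙ :=
    (integrable_const (1 : ℝ)).indicator₀ hS
  have hIF : ∫ ω, {ω | Hh ω ≤ B0}.indicator (1 : Ω → ℝ) ω ∂ℙ = F B0 := by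
    rw [integral_indicator₀ hS, hF]
    simp [Measure.real]
  set slope : Ω → ℝ := fun ω =>
    (B - B0) * ((laml - lamh) + (lamh - muh) * {ω | Hh ω ≤ B0}.indicator (1 : Ω → ℝ) ω)
  have hslope : Integrable slope ℙ :=
    ((integrable_const (laml - lamh)).add (hI.const_mul (lamh - muh))).const_mul (B - B0)
  have hslope_integral : ∫ ω, slope ω ∂ℙ = (B - B0) * (-lamb) := by
    rw [integral_const_mul, integral_add (integrable_const _) (hI.const_mul _),
      integral_const_mul, hIF, hB0, mul_div_cancel₀ _ (sub_pos.mpr hprice).ne']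
    simp only [integral_const, probReal_univ, one_smul]
    ring
  have hmono := integral_mono ((hint B0).add hslope) (hint B) fun ω => by
    have hsub := posPart_cost_subgradient hprice.le (Hh ω) B0 B
    have hind : (Set.Iic B0).indicator (1 : ℝ → ℝ) (Hh ω)
        = {ω | Hh ω ≤ B0}.indicator (1 : Ω → ℝ) ω := rfl
    rw [hind] at hsub
    simp only [Pi.add_apply, slope]
    linarith
  rw [integral_add' (hint B0) hslope, hslope_integral] at hmono
  rw [hJ, hJ]
  linarith
end

section
/- Let B⁰ ∈ ℝ satisfy F(B⁰) = (λ_h − λ_l − λ_b)/(λ_h − μ_h) and assume ℙ(H_h = B⁰) = 0. Then the optimal cost equals J(B⁰) = λ_h·E[H_h·𝟙{H_h ≥ B⁰}] + μ_h·E[H_h·𝟙{H_h < B⁰}] + λ_l·E[H_l], where 𝟙{·} denotes the indicator of the event. -/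
open MeasureTheory

/-- At an optimal storage capacity `B⁰` satisfying the first-order
condition (with `ℙ(H_h = B⁰) = 0`), the optimal cost is
`J(B⁰) = λ_h·E[H_h·𝟙{H_h ≥ B⁰}] + μ_h·E[H_h·𝟙{H_h < B⁰}] + λ_l·E[H_l]`. -/
theorem optimal_storage_cost_formula
    {Ω : Type*} [MeasurableSpace Ω] (ℙ : Measure Ω) [IsProbabilityMeasure ℙ]
    (Hh Hl : Ω → ℝ) (hHh : Integrable Hh ℙ) (hHl : Integrable Hl ℙ)
    (lamh muh laml lamb : ℝ) (hprice : lamh > muh)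
    (F : ℝ → ℝ) (hF : ∀ x, F x = (ℙ {ω | Hh ω ≤ x}).toReal)
    (J : ℝ → ℝ)
    (hJ : ∀ B, J B = lamb * B +
      ∫ ω, (lamh * max (Hh ω - B) 0 - muh * max (B - Hh ω) 0
            + laml * (Hl ω + B)) ∂ℙ)
    (B0 : ℝ) (hB0 : F B0 = (lamh - laml - lamb) / (lamh - muh))
    (hatom : ℙ {ω | Hh ω = B0} = 0) :
    J B0 = lamh * (∫ ω, Set.indicator {ω | B0 ≤ Hh ω} Hh ω ∂ℙ)
         + muh * (∫ ω, Set.indicator {ω | Hh ω < B0} Hh ω ∂ℙ)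
         + laml * (∫ ω, Hl ω ∂ℙ) := by
  have hlt : NullMeasurableSet {ω | Hh ω < B0} ℙ :=
    nullMeasurableSet_lt hHh.aemeasurable aemeasurable_const
  have hge : NullMeasurableSet {ω | B0 ≤ Hh ω} ℙ :=
    nullMeasurableSet_le aemeasurable_const hHh.aemeasurable
  have hF_lt : ℙ.real {ω | Hh ω < B0} = F B0 := by
    rw [hF, ← Measure.real]
    refine measureReal_congr ?_
    have hne : ∀ᵐ ω ∂ℙ, Hh ω ≠ B0 := by simpa [ae_iff] using hatom
    filter_upwards [hne] with ω hω
    exact propext (lt_iff_le_and_ne.trans (and_iff_left hω))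
  have hsplit : ∀ ω, lamh * max (Hh ω - B0) 0 - muh * max (B0 - Hh ω) 0 + laml * (Hl ω + B0)
      = lamh * Set.indicator {ω | B0 ≤ Hh ω} Hh ω + muh * Set.indicator {ω | Hh ω < B0} Hh ω
        + laml * Hl ω
        + (lamh - muh) * B0 * Set.indicator {ω | Hh ω < B0} (fun _ => (1 : ℝ)) ω
        + (laml - lamh) * B0 := by
    intro ω
    rcases lt_or_ge (Hh ω) B0 with h | h
    · simp only [Set.indicator, Set.mem_ofPred_eq, h, not_le.mpr h, if_true, if_false,
        max_eq_right (sub_nonpos.mpr h.le), max_eq_left (sub_nonneg.mpr h.le)]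
      ring
    · simp only [Set.indicator, Set.mem_ofPred_eq, h, not_lt.mpr h, if_true, if_false,
        max_eq_left (sub_nonneg.mpr h), max_eq_right (sub_nonpos.mpr h)]
      ring
  have hint_ge := (hHh.indicator₀ hge).const_mul lamh
  have hint_lt := (hHh.indicator₀ hlt).const_mul muh
  have hint_l := hHl.const_mul laml
  have hint_one := ((integrable_const (μ := ℙ) (1 : ℝ)).indicator₀ hlt).const_mul
    ((lamh - muh) * B0)
  have hone : ∫ ω, Set.indicator {ω | Hh ω < B0} (fun _ => (1 : ℝ)) ω ∂ℙ = F B0 := by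
    rw [integral_indicator₀ hlt, setIntegral_const, hF_lt, smul_eq_mul, mul_one]
  have hfoc : (lamh - muh) * F B0 = lamh - laml - lamb := by
    rw [hB0, mul_div_cancel₀ _ (sub_pos.mpr hprice).ne']
  rw [hJ, integral_congr_ae (.of_forall hsplit), integral_add (by fun_prop) (by fun_prop),
    integral_add (by fun_prop) hint_one, integral_add (by fun_prop) hint_l,
    integral_add hint_ge hint_lt]
  simp only [integral_const_mul, hone, integral_const, probReal_univ, one_smul]
  linear_combination B0 * hfoc
end

section
/- Let H be an integrable real random variable whose cumulative distribution function F is continuous at a point B₀ ∈ ℝ. Then the function B ↦ E[max(H − B, 0)] is differentiable at B₀ with derivative −(1 − F(B₀)). -/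
open MeasureTheory

open Filter Topology

/-- A random variable has no atom at a continuity point of its cumulative distribution function. -/
theorem measure_fiber_eq_zero_of_continuousAt_cdf
    {Ω : Type*} [MeasurableSpace Ω] {μ : Measure Ω} [IsFiniteMeasure μ]
    {H : Ω → ℝ} (hH : AEMeasurable H μ) {b : ℝ}
    (hcont : ContinuousAt (fun x => μ.real {ω | H ω ≤ x}) b) :
    μ {ω | H ω = b} = 0 := by
  have key : ∀ x < b, μ.real {ω | H ω = b} ≤ μ.real {ω | H ω ≤ b} - μ.real {ω | H ω ≤ x} := by
    intro x hx
    have hdisj : Disjoint {ω | H ω = b} {ω | H ω ≤ x} :=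
      Set.disjoint_left.2 fun ω (h : H ω = b) (h' : H ω ≤ x) => by linarith
    have hunion : μ.real ({ω | H ω = b} ∪ {ω | H ω ≤ x})
        = μ.real {ω | H ω = b} + μ.real {ω | H ω ≤ x} :=
      measureReal_union₀ (hH.nullMeasurableSet_preimage measurableSet_Iic) hdisj.aedisjoint
    have hle : μ.real ({ω | H ω = b} ∪ {ω | H ω ≤ x}) ≤ μ.real {ω | H ω ≤ b} :=
      measureReal_mono (Set.union_subset (fun ω h => le_of_eq h) fun ω h => le_trans h hx.le)
    linarith
  have hlim : Tendsto (fun x => μ.real {ω | H ω ≤ b} - μ.real {ω | H ω ≤ x}) (𝓝[<] b) (𝓝 0) := by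
    rw [← sub_self (μ.real {ω | H ω ≤ b})]
    exact tendsto_const_nhds.sub (hcont.tendsto.mono_left nhdsWithin_le_nhds)
  have hle : μ.real {ω | H ω = b} ≤ 0 :=
    ge_of_tendsto hlim (eventually_nhdsWithin_of_forall key)
  exact (measureReal_eq_zero_iff).1 (le_antisymm hle measureReal_nonneg)

/-- Away from its kink at `h`, the function `B ↦ max (h - B) 0` is differentiable. -/
theorem hasDerivAt_max_sub_zero {h b : ℝ} (hne : h ≠ b) :
    HasDerivAt (fun B : ℝ => max (h - B) 0) (if h ≤ b then 0 else -1) b := by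
  rcases hne.lt_or_gt with hlt | hgt
  · rw [if_pos hlt.le]
    refine (hasDerivAt_const b (0 : ℝ)).congr_of_eventuallyEq ?_
    filter_upwards [lt_mem_nhds hlt] with B hB
    exact max_eq_right (by linarith)
  · rw [if_neg hgt.not_ge]
    refine ((hasDerivAt_id b).const_sub h).congr_of_eventuallyEq ?_
    filter_upwards [gt_mem_nhds hgt] with B hB
    exact max_eq_left (by simpa using hB.le)

/-- If the cdf `F` of an integrable random variable `H` is
continuous at `B₀`, then `B ↦ E[max(H − B, 0)]` is differentiable at `B₀`
with derivative `−(1 − F(B₀))`. -/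
theorem expected_shortfall_hasDerivAt
    {Ω : Type*} [MeasurableSpace Ω] (ℙ : Measure Ω) [IsProbabilityMeasure ℙ]
    (H : Ω → ℝ) (hH : Integrable H ℙ)
    (F : ℝ → ℝ) (hF : ∀ x, F x = (ℙ {ω | H ω ≤ x}).toReal)
    (B0 : ℝ) (hcont : ContinuousAt F B0) :
    HasDerivAt (fun B : ℝ => ∫ ω, max (H ω - B) 0 ∂ℙ) (-(1 - F B0)) B0 := by
  obtain rfl : F = fun x => ℙ.real {ω | H ω ≤ x} := funext hF
  have hint : ∀ B : ℝ, Integrable (fun ω => max (H ω - B) 0) ℙ := fun B =>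
    (hH.sub (integrable_const B)).pos_part
  have hA : NullMeasurableSet {ω | H ω ≤ B0} ℙ :=
    hH.aemeasurable.nullMeasurableSet_preimage measurableSet_Iic
  have hind : Integrable ({ω | H ω ≤ B0}.indicator fun _ => (1 : ℝ)) ℙ :=
    (integrable_const 1).indicator₀ hA
  have hval : ∫ ω, ({ω | H ω ≤ B0}.indicator (fun _ => (1 : ℝ)) ω - 1) ∂ℙ
      = -(1 - ℙ.real {ω | H ω ≤ B0}) := by
    rw [integral_sub hind (integrable_const 1), integral_indicator₀ hA]
    simp
  rw [← hval]
  refine (hasDerivAt_integral_of_dominated_loc_of_lip (bound := fun _ => (1 : ℝ)) univ_mem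
    (Eventually.of_forall fun B => (hint B).aestronglyMeasurable) (hint B0)
    (hind.sub (integrable_const 1)).aestronglyMeasurable
    (Eventually.of_forall fun ω => ?_) (integrable_const 1) ?_).2
  · refine LipschitzOnWith.of_dist_le_mul fun x _ y _ => ?_
    have h := abs_max_sub_max_le_abs (H ω - x) (H ω - y) 0
    rw [sub_sub_sub_cancel_left, abs_sub_comm y x] at h
    simpa [Real.dist_eq] using h
  · have hne : ∀ᵐ ω ∂ℙ, H ω ≠ B0 := by
      simpa [ae_iff] using measure_fiber_eq_zero_of_continuousAt_cdf hH.aemeasurable hcont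
    filter_upwards [hne] with ω hω
    refine (hasDerivAt_max_sub_zero hω).congr_deriv ?_
    by_cases h : H ω ≤ B0 <;> simp [h]
end

section
/- Let H be an integrable real random variable whose cumulative distribution function F is continuous at a point B₀ ∈ ℝ. Then the function B ↦ E[max(B − H, 0)] is differentiable at B₀ with derivative F(B₀). -/
open MeasureTheory

/-- If the cdf of a real random variable is continuous at `b`, then `b` carries no mass. -/
theorem measure_eq_zero_of_continuousAt_cdf
    {Ω : Type*} [MeasurableSpace Ω] {μ : Measure Ω} [IsFiniteMeasure μ]
    {X : Ω → ℝ} (hX : AEMeasurable X μ) {b : ℝ}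
    (hcont : ContinuousAt (fun x ↦ μ.real {ω | X ω ≤ x}) b) :
    μ {ω | X ω = b} = 0 := by
  have hle : ∀ x < b, μ.real {ω | X ω = b} ≤
      μ.real {ω | X ω ≤ b} - μ.real {ω | X ω ≤ x} := by
    intro x hx
    have hdisj : Disjoint {ω | X ω = b} {ω | X ω ≤ x} :=
      Set.disjoint_left.2 fun ω (h₁ : X ω = b) (h₂ : X ω ≤ x) ↦ by linarith
    have hmeas : NullMeasurableSet {ω | X ω ≤ x} μ := hX.nullMeasurable measurableSet_Iic
    rw [le_sub_iff_add_le, ← measureReal_union₀ hmeas hdisj.aedisjoint]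
    refine measureReal_mono ?_
    rintro ω (h | h)
    · exact le_of_eq h
    · exact le_trans h hx.le
  have hlim : Filter.Tendsto (fun x ↦ μ.real {ω | X ω ≤ b} - μ.real {ω | X ω ≤ x})
      (nhdsWithin b (Set.Iio b)) (nhds (μ.real {ω | X ω ≤ b} - μ.real {ω | X ω ≤ b})) :=
    (hcont.tendsto.mono_left nhdsWithin_le_nhds).const_sub _
  rw [sub_self] at hlim
  have h := ge_of_tendsto hlim (eventually_nhdsWithin_of_forall hle)
  exact (measureReal_eq_zero_iff).1 (le_antisymm h measureReal_nonneg)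

/-- Away from its kink, the function `x ↦ max (x - h) 0` has derivative `1_{h ≤ x}`. -/
theorem hasDerivAt_max_sub_zero_s3 {h b : ℝ} (hne : h ≠ b) :
    HasDerivAt (fun x : ℝ ↦ max (x - h) 0) ((Set.Iic b).indicator (fun _ ↦ (1 : ℝ)) h) b := by
  rcases lt_or_gt_of_ne hne with hlt | hlt
  · rw [Set.indicator_of_mem (Set.mem_Iic.2 hlt.le)]
    refine ((hasDerivAt_id b).sub_const h).congr_of_eventuallyEq ?_
    filter_upwards [lt_mem_nhds hlt] with x hx
    exact max_eq_left (sub_nonneg.2 hx.le)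
  · rw [Set.indicator_of_notMem (by simpa using hlt)]
    refine (hasDerivAt_const b (0 : ℝ)).congr_of_eventuallyEq ?_
    filter_upwards [gt_mem_nhds hlt] with x hx
    exact max_eq_right (sub_nonpos.2 hx.le)

/-- If the cdf `F` of an integrable random variable `H` is
continuous at `B₀`, then `B ↦ E[max(B − H, 0)]` is differentiable at `B₀`
with derivative `F(B₀)`. -/
theorem expected_surplus_hasDerivAt
    {Ω : Type*} [MeasurableSpace Ω] (ℙ : Measure Ω) [IsProbabilityMeasure ℙ]
    (H : Ω → ℝ) (hH : Integrable H ℙ)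
    (F : ℝ → ℝ) (hF : ∀ x, F x = (ℙ {ω | H ω ≤ x}).toReal)
    (B0 : ℝ) (hcont : ContinuousAt F B0) :
    HasDerivAt (fun B : ℝ => ∫ ω, max (B - H ω) 0 ∂ℙ) (F B0) B0 := by
  have hae : AEMeasurable H ℙ := hH.aemeasurable
  have hnull : ℙ {ω | H ω = B0} = 0 :=
    measure_eq_zero_of_continuousAt_cdf hae (by rwa [funext hF] at hcont)
  have hint : ∀ B : ℝ, Integrable (fun ω ↦ max (B - H ω) 0) ℙ := fun B ↦
    ((integrable_const B).sub hH).pos_part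
  have hne : ∀ᵐ ω ∂ℙ, H ω ≠ B0 := by
    simpa [ae_iff] using hnull
  have hderiv := (hasDerivAt_integral_of_dominated_loc_of_lip (μ := ℙ) (x₀ := B0)
    (F := fun B ω ↦ max (B - H ω) 0) (bound := fun _ ↦ (1 : ℝ))
    (F' := fun ω ↦ (Set.Iic B0).indicator (fun _ ↦ (1 : ℝ)) (H ω)) Filter.univ_mem
    (Filter.Eventually.of_forall fun B ↦ (hint B).aestronglyMeasurable) (hint B0)
    ((measurable_const.indicator measurableSet_Iic).comp_aemeasurable hae).aestronglyMeasurable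
    (Filter.Eventually.of_forall fun ω ↦ LipschitzOnWith.of_dist_le_mul fun x _ y _ ↦ by
      simpa [Real.dist_eq] using abs_max_sub_max_le_abs (x - H ω) (y - H ω) 0)
    (integrable_const 1)
    (hne.mono fun ω hω ↦ hasDerivAt_max_sub_zero_s3 hω)).2
  have hval : ∫ ω, (Set.Iic B0).indicator (fun _ ↦ (1 : ℝ)) (H ω) ∂ℙ = F B0 := by
    change ∫ ω, (H ⁻¹' Set.Iic B0).indicator (fun _ ↦ (1 : ℝ)) ω ∂ℙ = F B0
    rw [integral_indicator₀ (hae.nullMeasurable measurableSet_Iic), hF]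
    simp [Measure.real, Set.preimage, Set.mem_Iic]
  rwa [hval] at hderiv
end

section
/- Assume equal buying and selling prices in each period (peak selling price equals λ_h and off-peak selling price equals λ_l) and let a_max ≥ 0. If λ_h·E[S_h] + λ_l·E[S_l] ≥ λ_a, then a⁰ = a_max minimizes J over the interval [0, a_max], i.e. J(a_max) ≤ J(a) for all a ∈ [0, a_max]; and if λ_h·E[S_h] + λ_l·E[S_l] < λ_a, then a⁰ = 0 minimizes J over [0, a_max], i.e. J(0) ≤ J(a) for all a ∈ [0, a_max]. -/
open MeasureTheory

/-- Under net metering at equal prices, buying minus selling bills the signed net demand. -/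
theorem mul_max_zero_sub_mul_max_zero {x y : ℝ} (p : ℝ) (h : y = -x) :
    p * max x 0 - p * max y 0 = p * x := by
  rw [h, ← mul_sub, max_zero_sub_max_neg_zero_eq_self]

/-- With equal buying and selling prices in each period and
`a_max ≥ 0`: if `λ_h·E[S_h] + λ_l·E[S_l] ≥ λ_a` then `a⁰ = a_max` minimizes
the expected daily cost `J` over `[0, a_max]`; otherwise `a⁰ = 0` does. -/
theorem optimal_solar_area
    {Ω : Type*} [MeasurableSpace Ω] (ℙ : Measure Ω) [IsProbabilityMeasure ℙ]
    (Hh Hl Sh Sl : Ω → ℝ)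
    (hHh : Integrable Hh ℙ) (hHl : Integrable Hl ℙ)
    (hSh : Integrable Sh ℙ) (hSl : Integrable Sl ℙ)
    (lamh laml lama lamb B : ℝ)
    (amax : ℝ) (hamax : 0 ≤ amax)
    (J : ℝ → ℝ)
    (hJ : ∀ a, J a = lamb * B + lama * a +
      ∫ ω, (lamh * max (Hh ω - a * Sh ω - B) 0
            - lamh * max (a * Sh ω + B - Hh ω) 0
            + laml * max (Hl ω + B - a * Sl ω) 0
            - laml * max (a * Sl ω - B - Hl ω) 0) ∂ℙ) :
    (lamh * (∫ ω, Sh ω ∂ℙ) + laml * (∫ ω, Sl ω ∂ℙ) ≥ lama →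
      ∀ a ∈ Set.Icc (0 : ℝ) amax, J amax ≤ J a) ∧
    (lamh * (∫ ω, Sh ω ∂ℙ) + laml * (∫ ω, Sl ω ∂ℙ) < lama →
      ∀ a ∈ Set.Icc (0 : ℝ) amax, J 0 ≤ J a) := by
  have key : ∀ a, J a = lamb * B + lama * a +
      ((∫ ω, (lamh * (Hh ω - B) + laml * (Hl ω + B)) ∂ℙ) -
        a * (lamh * (∫ ω, Sh ω ∂ℙ) + laml * (∫ ω, Sl ω ∂ℙ))) := by
    intro a
    have hconst : Integrable (fun ω => lamh * (Hh ω - B) + laml * (Hl ω + B)) ℙ := by fun_prop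
    have hslope : Integrable (fun ω => a * (lamh * Sh ω + laml * Sl ω)) ℙ := by fun_prop
    rw [hJ a, ← integral_const_mul, ← integral_const_mul,
      ← integral_add (hSh.const_mul lamh) (hSl.const_mul laml), ← integral_const_mul,
      ← integral_sub hconst hslope]
    congr 2 with ω
    have hh := mul_max_zero_sub_mul_max_zero lamh
      (show a * Sh ω + B - Hh ω = -(Hh ω - a * Sh ω - B) by ring)
    have hl := mul_max_zero_sub_mul_max_zero laml
      (show a * Sl ω - B - Hl ω = -(Hl ω + B - a * Sl ω) by ring)
    linear_combination hh + hl
  constructor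
  · rintro h a ⟨-, ha⟩
    rw [key, key]
    nlinarith [mul_nonneg (sub_nonneg.2 ha) (sub_nonneg.2 h)]
  · rintro h a ⟨ha, -⟩
    rw [key, key]
    nlinarith [mul_nonneg ha (sub_nonneg.2 h.le)]
end

section
/- Assume H_h ≥ 0 almost surely and let B⁰ ∈ ℝ satisfy F(B⁰) = (λ_h − λ_l − λ_b)/(λ_h − μ_h). Then J(B⁰) ≤ C, where C = λ_h·E[H_h] + λ_l·E[H_l] is the daily expected cost of the household without storage; that is, investing in the optimal storage capacity never increases the expected daily electricity cost. -/
open MeasureTheory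

/-- If `H_h ≥ 0` almost surely and `B⁰` satisfies the first-order
condition `F(B⁰) = (λ_h − λ_l − λ_b)/(λ_h − μ_h)`, then
`J(B⁰) ≤ C = λ_h·E[H_h] + λ_l·E[H_l]`: investing in the optimal storage
capacity never increases the expected daily electricity cost. -/
theorem optimal_storage_saves_money
    {Ω : Type*} [MeasurableSpace Ω] (ℙ : Measure Ω) [IsProbabilityMeasure ℙ]
    (Hh Hl : Ω → ℝ) (hHh : Integrable Hh ℙ) (hHl : Integrable Hl ℙ)
    (hpos : ∀ᵐ ω ∂ℙ, 0 ≤ Hh ω)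
    (lamh muh laml lamb : ℝ) (hprice : lamh > muh)
    (F : ℝ → ℝ) (hF : ∀ x, F x = (ℙ {ω | Hh ω ≤ x}).toReal)
    (J : ℝ → ℝ)
    (hJ : ∀ B, J B = lamb * B +
      ∫ ω, (lamh * max (Hh ω - B) 0 - muh * max (B - Hh ω) 0
            + laml * (Hl ω + B)) ∂ℙ)
    (B0 : ℝ) (hB0 : F B0 = (lamh - laml - lamb) / (lamh - muh)) :
    J B0 ≤ lamh * (∫ ω, Hh ω ∂ℙ) + laml * (∫ ω, Hl ω ∂ℙ) := by
  let S : Set Ω := {ω | Hh ω ≤ B0}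
  have hSm : NullMeasurableSet S ℙ := nullMeasurableSet_le hHh.aemeasurable aemeasurable_const
  have hind : Integrable (S.indicator fun _ => B0) ℙ := (integrable_const B0).indicator₀ hSm
  have hintInd : ∫ ω, S.indicator (fun _ => B0) ω ∂ℙ = F B0 * B0 := by
    rw [integral_indicator₀ hSm, setIntegral_const, hF, smul_eq_mul, Measure.real]
  have hbuy : Integrable (fun ω => lamh * (Hh ω - B0)) ℙ :=
    (hHh.sub (integrable_const B0)).const_mul lamh
  have hgap : Integrable (fun ω => (lamh - muh) * S.indicator (fun _ => B0) ω) ℙ :=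
    hind.const_mul _
  have hbuygap : Integrable (fun ω => lamh * (Hh ω - B0)
      + (lamh - muh) * S.indicator (fun _ => B0) ω) ℙ := hbuy.add hgap
  have hoff : Integrable (fun ω => laml * (Hl ω + B0)) ℙ :=
    (hHl.add (integrable_const B0)).const_mul laml
  have hcost : Integrable (fun ω => lamh * max (Hh ω - B0) 0 - muh * max (B0 - Hh ω) 0
      + laml * (Hl ω + B0)) ℙ :=
    (((hHh.sub (integrable_const B0)).pos_part.const_mul lamh).sub
      (((integrable_const B0).sub hHh).pos_part.const_mul muh)).add hoff
  have hle : ∫ ω, (lamh * max (Hh ω - B0) 0 - muh * max (B0 - Hh ω) 0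
      + laml * (Hl ω + B0)) ∂ℙ ≤
      ∫ ω, (lamh * (Hh ω - B0) + (lamh - muh) * S.indicator (fun _ => B0) ω
        + laml * (Hl ω + B0)) ∂ℙ := by
    refine integral_mono_ae hcost (hbuygap.add hoff) ?_
    filter_upwards [hpos] with ω hω
    by_cases h : Hh ω ≤ B0
    · have hmem : ω ∈ S := h
      rw [Set.indicator_of_mem hmem, max_eq_right (by linarith), max_eq_left (by linarith)]
      nlinarith [mul_nonneg (sub_pos.2 hprice).le hω]
    · have hmem : ω ∉ S := h
      rw [Set.indicator_of_notMem hmem, max_eq_left (by linarith), max_eq_right (by linarith)]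
      linarith
  have hval : ∫ ω, (lamh * (Hh ω - B0) + (lamh - muh) * S.indicator (fun _ => B0) ω
      + laml * (Hl ω + B0)) ∂ℙ = lamh * ((∫ ω, Hh ω ∂ℙ) - B0) + (lamh - muh) * (F B0 * B0)
        + laml * ((∫ ω, Hl ω ∂ℙ) + B0) := by
    rw [integral_add hbuygap hoff, integral_add hbuy hgap, integral_const_mul,
      integral_const_mul, integral_const_mul, hintInd, integral_sub hHh (integrable_const B0),
      integral_add hHl (integrable_const B0)]
    simp
  have hfoc : (lamh - muh) * F B0 = lamh - laml - lamb := by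
    rw [hB0, mul_div_cancel₀ _ (sub_pos.2 hprice).ne']
  rw [hJ]
  linear_combination hle + hval + B0 * hfoc
end
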